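/- arXiv:1812.03847 — 2 statements merged into one kernel-verified Lean document; each statement's English description precedes it below -/
import Mathlib

section
/- Let M ≥ 1 and R, S ≥ 0 be integers with R + S = M, and D > 0 a real number. Fix v₁ = (x₁,y₁), v₂ = (x₂,y₂) ∈ ℤ² with x₂ − x₁ = R and y₂ − y₁ = S. If P is a uniformly random up-right lattice path from v₁ to v₂, then the probability that some vertex of P has distance at least D from the line through v₁ and v₂ is less than 48·M³·exp(−D²/(4M)). -/
open Real

open scoped Classical

/-- The point `(u, v)` of the Euclidean plane. -/
noncomputable def pt (u v : ℝ) : EuclideanSpace ℝ (Fin 2) :=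
  (WithLp.equiv 2 (Fin 2 → ℝ)).symm ![u, v]

/-- The line through two points of the Euclidean plane. -/
def lineThrough (u v : EuclideanSpace ℝ (Fin 2)) : Set (EuclideanSpace ℝ (Fin 2)) :=
  {q | ∃ t : ℝ, q = u + t • (v - u)}

/-- An up-right path from `v₁` is encoded by its sequence of steps `s : Fin M → Bool`
(`true` = east step, `false` = north step); its `k`-th vertex. -/
noncomputable def pathVertex (x₁ y₁ : ℤ) {M : ℕ} (s : Fin M → Bool) (k : ℕ) :
    EuclideanSpace ℝ (Fin 2) :=
  pt ((x₁ : ℝ) + ((Finset.univ.filter (fun i : Fin M => i.val < k ∧ s i = true)).card : ℝ))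
     ((y₁ : ℝ) + ((Finset.univ.filter (fun i : Fin M => i.val < k ∧ s i = false)).card : ℝ))

/-- The terms of the binomial expansion of `(R + S) ^ (R + S)` are maximal at index `R`. -/
lemma choose_mul_pow_le_mode (R S j : ℕ) (hj : j ≤ R + S) :
    (R + S).choose j * R ^ j * S ^ (R + S - j) ≤ (R + S).choose R * R ^ R * S ^ S := by
  have step (j : ℕ) (hj : j < R + S) :
      (j < R → (R + S).choose j * R ^ j * S ^ (R + S - j) ≤
        (R + S).choose (j + 1) * R ^ (j + 1) * S ^ (R + S - (j + 1))) ∧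
      (R ≤ j → (R + S).choose (j + 1) * R ^ (j + 1) * S ^ (R + S - (j + 1)) ≤
        (R + S).choose j * R ^ j * S ^ (R + S - j)) := by
    obtain ⟨m, hm⟩ : ∃ m, R + S = j + 1 + m := ⟨R + S - (j + 1), by omega⟩
    have e1 : R + S - j = m + 1 := by omega
    have e2 : R + S - (j + 1) = m := by omega
    have hc := Nat.choose_succ_right_eq (R + S) j
    rw [e1] at hc
    rw [e1, e2]
    constructor
    · intro h
      have h1 : S * (j + 1) ≤ R * (m + 1) := by
        obtain ⟨a, rfl⟩ : ∃ a, R = j + 1 + a := ⟨R - (j + 1), by omega⟩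
        have : m = a + S := by omega
        subst this
        nlinarith [Nat.zero_le (a * a), Nat.zero_le (a * S), Nat.zero_le (a * j),
          Nat.zero_le (j + a)]
      refine Nat.le_of_mul_le_mul_right (c := j + 1) ?_ (Nat.succ_pos j)
      calc (R + S).choose j * R ^ j * S ^ (m + 1) * (j + 1)
          = (R + S).choose j * R ^ j * S ^ m * (S * (j + 1)) := by ring
        _ ≤ (R + S).choose j * R ^ j * S ^ m * (R * (m + 1)) := Nat.mul_le_mul_left _ h1
        _ = ((R + S).choose j * (m + 1)) * R ^ (j + 1) * S ^ m := by ring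
        _ = (R + S).choose (j + 1) * R ^ (j + 1) * S ^ m * (j + 1) := by rw [← hc]; ring
    · intro h
      have h1 : R * (m + 1) ≤ S * (j + 1) := by
        obtain ⟨a, rfl⟩ : ∃ a, j = R + a := ⟨j - R, by omega⟩
        have : S = a + 1 + m := by omega
        subst this
        nlinarith [Nat.zero_le (a * a), Nat.zero_le (a * m), Nat.zero_le (a * R)]
      refine Nat.le_of_mul_le_mul_right (c := j + 1) ?_ (Nat.succ_pos j)
      calc (R + S).choose (j + 1) * R ^ (j + 1) * S ^ m * (j + 1)
          = ((R + S).choose j * (m + 1)) * R ^ (j + 1) * S ^ m := by rw [← hc]; ring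
        _ = (R + S).choose j * R ^ j * S ^ m * (R * (m + 1)) := by ring
        _ ≤ (R + S).choose j * R ^ j * S ^ m * (S * (j + 1)) := Nat.mul_le_mul_left _ h1
        _ = (R + S).choose j * R ^ j * S ^ (m + 1) * (j + 1) := by ring
  have eR : R + S - R = S := by omega
  rcases le_total j R with h | h
  · induction h using Nat.decreasingInduction with
    | self => rw [eR]
    | of_succ k hk ih => exact ((step k (by omega)).1 hk).trans (ih (by omega))
  · induction j, h using Nat.le_induction with
    | base => rw [eR]
    | succ k hk ih => exact ((step k (by omega)).2 hk).trans (ih (by omega))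

lemma one_le_succ_mul_choose_mul_pow {R S : ℕ} (h : 0 < R + S) :
    (1 : ℝ) ≤ ((R + S : ℕ) + 1) * ((R + S).choose R *
      (((R : ℝ) / (R + S : ℕ)) ^ R * ((S : ℝ) / (R + S : ℕ)) ^ S)) := by
  have hsum : (R + S) ^ (R + S) ≤
      (R + S + 1) * ((R + S).choose R * R ^ R * S ^ S) := by
    rw [add_pow]
    refine (Finset.sum_le_card_nsmul _ _ ((R + S).choose R * R ^ R * S ^ S) ?_).trans_eq ?_
    · intro j hj
      have := choose_mul_pow_le_mode R S j (by simpa [Nat.lt_succ_iff] using hj)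
      simp only [Nat.cast_id]
      linarith
    · simp
  have hM : (0 : ℝ) < (R + S : ℕ) := by exact_mod_cast h
  have hcast : ((R + S : ℕ) : ℝ) ^ (R + S) ≤
      ((R + S : ℕ) + 1) * ((R + S).choose R * (R : ℝ) ^ R * (S : ℝ) ^ S) := by
    exact_mod_cast hsum
  rw [div_pow, div_pow, div_mul_div_comm, ← pow_add, mul_div_assoc', mul_div_assoc',
    le_div_iff₀ (by positivity)]
  linarith

lemma card_filter_card_true_eq_choose (M R : ℕ) :
    (Finset.univ.filter (fun s : Fin M → Bool =>
      (Finset.univ.filter (fun i : Fin M => s i = true)).card = R)).card = M.choose R := by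
  have h : (Finset.powersetCard R (Finset.univ : Finset (Fin M))).card = M.choose R := by simp
  rw [← h]
  refine Finset.card_bij' (fun s _ => Finset.univ.filter (fun i : Fin M => s i = true))
    (fun A _ i => decide (i ∈ A)) ?_ ?_ ?_ ?_
  · intro s hs
    simpa [Finset.mem_powersetCard] using hs
  · intro A hA
    simpa [Finset.mem_powersetCard] using hA
  · intro s _
    ext i
    simp
  · intro A _
    ext i
    simp

/-- The moment generating function of a centred Bernoulli variable is at most `exp (l² / 2)`. -/
lemma bernoulli_mgf_le {p q : ℝ} (hp : 0 ≤ p) (hq : 0 ≤ q) (hpq : p + q = 1) (l : ℝ) :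
    p * exp (l * (1 - p)) + q * exp (l * (0 - p)) ≤ exp (l ^ 2 / 2) := by
  obtain rfl : q = 1 - p := by linarith
  set A := p * exp (l * (1 - p)) + (1 - p) * exp (l * (0 - p)) with hA
  set B := p * exp (-(l * (1 - p))) + (1 - p) * exp (-(l * (0 - p))) with hB
  have hA0 : 0 ≤ A := by positivity
  have hB1 : 1 ≤ B := by
    nlinarith [mul_le_mul_of_nonneg_left (add_one_le_exp (-(l * (1 - p)))) hp,
      mul_le_mul_of_nonneg_left (add_one_le_exp (-(l * (0 - p)))) hq]
  have hAB : A * B = 1 + 2 * p * (1 - p) * (cosh l - 1) := by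
    have e1 : exp (l * (1 - p)) * exp (-(l * (1 - p))) = 1 := by rw [← exp_add]; simp
    have e2 : exp (l * (0 - p)) * exp (-(l * (0 - p))) = 1 := by rw [← exp_add]; simp
    have e3 : exp (l * (1 - p)) * exp (-(l * (0 - p))) = exp l := by rw [← exp_add]; ring_nf
    have e4 : exp (l * (0 - p)) * exp (-(l * (1 - p))) = exp (-l) := by
      rw [← exp_add]; ring_nf
    rw [cosh_eq]
    linear_combination p ^ 2 * e1 + (1 - p) ^ 2 * e2 + p * (1 - p) * e3 + p * (1 - p) * e4
  have hc : 1 ≤ cosh l := one_le_cosh l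
  calc A ≤ A * B := le_mul_of_one_le_right hA0 hB1
    _ ≤ cosh l := by rw [hAB]; nlinarith [sq_nonneg (2 * p - 1)]
    _ ≤ exp (l ^ 2 / 2) := cosh_le_exp_half_sq l

/-- Chernoff's method: the exponential moment of the centred number of `true` values among the
first `k` coordinates, under the product Bernoulli measure. -/
lemma sum_bernoulli_weight_mul_exp_le {M k : ℕ} (hk : k ≤ M) {p q : ℝ} (hp : 0 ≤ p)
    (hq : 0 ≤ q) (hpq : p + q = 1) (l : ℝ) :
    ∑ s : Fin M → Bool, (∏ i, if s i = true then p else q) *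
      exp (l * ((Finset.univ.filter (fun i : Fin M => i.val < k ∧ s i = true)).card - k * p)) ≤
      exp (M * (l ^ 2 / 2)) := by
  have hcard : (Finset.univ.filter (fun i : Fin M => i.val < k)).card = k := by
    rw [Fin.card_filter_val_lt]; simpa using hk
  have hterm (s : Fin M → Bool) : (∏ i, if s i = true then p else q) *
      exp (l * ((Finset.univ.filter (fun i : Fin M => i.val < k ∧ s i = true)).card - k * p)) =
      ∏ i : Fin M, (if s i = true then p else q) *
        (if i.val < k then exp (l * ((if s i = true then 1 else 0) - p)) else 1) := by
    rw [Finset.prod_mul_distrib]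
    congr 1
    rw [← Finset.prod_filter, ← exp_sum, ← Finset.mul_sum, Finset.sum_sub_distrib,
      Finset.sum_const, hcard, Finset.sum_boole, Finset.filter_filter, nsmul_eq_mul]
  simp_rw [hterm]
  have hprod := Finset.prod_univ_sum (fun _ : Fin M => (Finset.univ : Finset Bool))
    (fun (i : Fin M) (b : Bool) => (if b = true then p else q) *
        (if i.val < k then exp (l * ((if b = true then 1 else 0) - p)) else 1))
  rw [Fintype.piFinset_univ] at hprod
  rw [← hprod]
  have hpow : exp (M * (l ^ 2 / 2)) = ∏ _i : Fin M, exp (l ^ 2 / 2) := by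
    rw [Finset.prod_const, Finset.card_univ, Fintype.card_fin, exp_nat_mul]
  rw [hpow]
  refine Finset.prod_le_prod (fun i _ => Finset.sum_nonneg fun b _ => ?_) fun i _ => ?_
  · split_ifs <;> positivity
  · rw [Fintype.sum_bool]
    by_cases hi : i.val < k
    · simpa [hi] using bernoulli_mgf_le hp hq hpq l
    · simpa [hi, hpq] using (by positivity : 0 ≤ l ^ 2 / 2)

lemma infDist_pathVertex_le {M R S k : ℕ} (hM : 1 ≤ M) (hRS : R + S = M) (hk : k ≤ M)
    {x₁ y₁ x₂ y₂ : ℤ} (hx : x₂ - x₁ = (R : ℤ)) (hy : y₂ - y₁ = (S : ℤ)) (s : Fin M → Bool) :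
    Metric.infDist (pathVertex x₁ y₁ s k) (lineThrough (pt x₁ y₁) (pt x₂ y₂)) ≤
      √(2 * ((Finset.univ.filter (fun i : Fin M => i.val < k ∧ s i = true)).card -
        k * ((R : ℝ) / M)) ^ 2) := by
  have hM0 : (M : ℝ) ≠ 0 := by positivity
  have hx' : (x₂ : ℝ) = x₁ + R := by exact_mod_cast (by linarith : x₂ = x₁ + (R : ℤ))
  have hy' : (y₂ : ℝ) = y₁ + S := by exact_mod_cast (by linarith : y₂ = y₁ + (S : ℤ))
  have hS : (S : ℝ) = M - R := by rw [← hRS]; push_cast; ring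
  have hcard : (Finset.univ.filter (fun i : Fin M => i.val < k ∧ s i = true)).card +
      (Finset.univ.filter (fun i : Fin M => i.val < k ∧ s i = false)).card = k := by
    have h := Finset.card_filter_add_card_filter_not
      (s := Finset.univ.filter (fun i : Fin M => i.val < k)) (fun i => s i = true)
    rw [Finset.filter_filter, Finset.filter_filter, Fin.card_filter_val_lt] at h
    simp only [Bool.not_eq_true] at h
    omega
  have hfalse : ((Finset.univ.filter (fun i : Fin M => i.val < k ∧ s i = false)).card : ℝ) =
      k - (Finset.univ.filter (fun i : Fin M => i.val < k ∧ s i = true)).card := by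
    rw [eq_sub_iff_add_eq', ← Nat.cast_add, hcard]
  have hmem : pt x₁ y₁ + ((k : ℝ) / M) • (pt x₂ y₂ - pt x₁ y₁) ∈
      lineThrough (pt x₁ y₁) (pt x₂ y₂) := ⟨_, rfl⟩
  refine (Metric.infDist_le_dist_of_mem hmem).trans_eq ?_
  rw [EuclideanSpace.dist_eq]
  congr 1
  simp only [pathVertex, pt, Fin.sum_univ_two, Real.dist_eq, sq_abs, hfalse, hx', hy', hS]
  simp
  field_simp
  ring

/-- A uniformly random up-right lattice path from `v₁ = (x₁,y₁)` to `v₂ = (x₂,y₂)`,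
where `x₂ - x₁ = R`, `y₂ - y₁ = S`, `R + S = M`, has some vertex at distance at least `D`
from the line through `v₁` and `v₂` with probability less than `48 M³ exp(-D²/(4M))`. -/
theorem random_walk_linear (M : ℕ) (hM : 1 ≤ M) (R S : ℕ) (hRS : R + S = M)
    (D : ℝ) (hD : 0 < D) (x₁ y₁ x₂ y₂ : ℤ)
    (hx : x₂ - x₁ = (R : ℤ)) (hy : y₂ - y₁ = (S : ℤ)) :
    (((Finset.univ.filter (fun s : Fin M → Bool =>
          (Finset.univ.filter (fun i : Fin M => s i = true)).card = R ∧
          ∃ k ≤ M, D ≤ Metric.infDist (pathVertex x₁ y₁ s k)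
            (lineThrough (pt x₁ y₁) (pt x₂ y₂)))).card : ℝ) /
        ((Finset.univ.filter (fun s : Fin M → Bool =>
          (Finset.univ.filter (fun i : Fin M => s i = true)).card = R)).card : ℝ)) <
      48 * M ^ 3 * Real.exp (-(D ^ 2) / (4 * M)) := by
  have hM0 : (0 : ℝ) < M := by exact_mod_cast hM
  have hM1 : (1 : ℝ) ≤ M := by exact_mod_cast hM
  rw [card_filter_card_true_eq_choose]
  set p : ℝ := (R : ℝ) / M with hp_def
  set q : ℝ := (S : ℝ) / M with hq_def
  set E := exp (-(D ^ 2) / (4 * M)) with hE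
  set B := Finset.univ.filter (fun s : Fin M → Bool =>
    (Finset.univ.filter (fun i : Fin M => s i = true)).card = R ∧
      ∃ k ≤ M, D ≤ Metric.infDist (pathVertex x₁ y₁ s k)
        (lineThrough (pt x₁ y₁) (pt x₂ y₂))) with hB
  have hp : 0 ≤ p := by positivity
  have hq : 0 ≤ q := by positivity
  have hpq : p + q = 1 := by
    rw [hp_def, hq_def, ← add_div, ← Nat.cast_add, hRS, div_self hM0.ne']
  have hmode : (1 : ℝ) ≤ (M + 1) * (M.choose R * (p ^ R * q ^ S)) := by
    subst hRS
    exact one_le_succ_mul_choose_mul_pow hM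
  have hweight (s : Fin M → Bool)
      (hs : (Finset.univ.filter (fun i : Fin M => s i = true)).card = R) :
      (∏ i, if s i = true then p else q) = p ^ R * q ^ S := by
    have h := Finset.card_filter_add_card_filter_not
      (s := (Finset.univ : Finset (Fin M))) (fun i => s i = true)
    rw [Finset.card_univ, Fintype.card_fin] at h
    rw [Finset.prod_ite, Finset.prod_const, Finset.prod_const, hs]
    congr 2
    omega
  let X (k : ℕ) (s : Fin M → Bool) : ℝ :=
    (Finset.univ.filter (fun i : Fin M => i.val < k ∧ s i = true)).card - k * p
  let l : ℝ := D / (√2 * M)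
  have hsq : √2 ^ 2 = 2 := sq_sqrt (by norm_num)
  have hs2 : 0 < √2 := by positivity
  have hl : l ^ 2 = D ^ 2 / (2 * M ^ 2) := by
    simp only [l]; rw [div_pow, mul_pow, hsq]
  have hl0 : 0 < l := by positivity
  have hpoint (s) (hs : s ∈ B) : p ^ R * q ^ S * exp (D ^ 2 / (2 * M)) ≤
      ∑ k ∈ Finset.range (M + 1), ((∏ i, if s i = true then p else q) * exp (l * X k s) +
        (∏ i, if s i = true then p else q) * exp (-l * X k s)) := by
    obtain ⟨-, hsR, k, hk, hD'⟩ := Finset.mem_filter.1 hs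
    have hdist := hD'.trans (infDist_pathVertex_le hM hRS hk hx hy s)
    rw [sqrt_mul (by norm_num), sqrt_sq_eq_abs] at hdist
    change D ≤ √2 * |X k s| at hdist
    rw [hweight s hsR]
    refine le_trans ?_ (Finset.single_le_sum (fun k _ => by positivity)
      (Finset.mem_range.2 (Nat.lt_succ_of_le hk)))
    rw [← mul_add]
    refine mul_le_mul_of_nonneg_left ?_ (by positivity)
    have hexp : D ^ 2 / (2 * M) ≤ l * |X k s| := by
      have : D ^ 2 / (2 * M) = l * (D / √2) := by
        simp only [l]; field_simp; rw [hsq]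
      rw [this]
      exact mul_le_mul_of_nonneg_left ((div_le_iff₀' hs2).2 hdist) hl0.le
    refine (exp_le_exp.2 hexp).trans ?_
    rcases abs_choice (X k s) with h | h <;> rw [h]
    · linarith [exp_pos (-l * X k s)]
    · rw [mul_neg, ← neg_mul]
      linarith [exp_pos (l * X k s)]
  have hbound : B.card * (p ^ R * q ^ S * exp (D ^ 2 / (2 * M))) ≤
      (M + 1) * (2 * exp (D ^ 2 / (4 * M))) := by
    calc B.card * (p ^ R * q ^ S * exp (D ^ 2 / (2 * M)))
        = ∑ s ∈ B, p ^ R * q ^ S * exp (D ^ 2 / (2 * M)) := by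
          rw [Finset.sum_const, nsmul_eq_mul]
      _ ≤ ∑ s ∈ B, ∑ k ∈ Finset.range (M + 1),
          ((∏ i, if s i = true then p else q) * exp (l * X k s) +
          (∏ i, if s i = true then p else q) * exp (-l * X k s)) := Finset.sum_le_sum hpoint
      _ ≤ ∑ s, ∑ k ∈ Finset.range (M + 1),
          ((∏ i, if s i = true then p else q) * exp (l * X k s) +
          (∏ i, if s i = true then p else q) * exp (-l * X k s)) := by
          refine Finset.sum_le_univ_sum_of_nonneg fun s => Finset.sum_nonneg fun k _ => ?_
          have : 0 ≤ ∏ i, if s i = true then p else q :=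
            Finset.prod_nonneg fun i _ => by split_ifs <;> assumption
          positivity
      _ = ∑ k ∈ Finset.range (M + 1),
          (∑ s : Fin M → Bool, (∏ i, if s i = true then p else q) * exp (l * X k s) +
          ∑ s : Fin M → Bool, (∏ i, if s i = true then p else q) * exp (-l * X k s)) := by
          rw [Finset.sum_comm]; simp_rw [Finset.sum_add_distrib]
      _ ≤ ∑ k ∈ Finset.range (M + 1), 2 * exp (D ^ 2 / (4 * M)) := by
          refine Finset.sum_le_sum fun k hk => ?_
          have hk' : k ≤ M := Nat.lt_succ_iff.1 (Finset.mem_range.1 hk)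
          have h1 := sum_bernoulli_weight_mul_exp_le hk' hp hq hpq l
          have h2 := sum_bernoulli_weight_mul_exp_le hk' hp hq hpq (-l)
          have he : M * (l ^ 2 / 2) = D ^ 2 / (4 * M) := by
            rw [hl]; field_simp; norm_num
          rw [neg_sq, he] at h2
          rw [he] at h1
          rw [two_mul]
          exact add_le_add h1 h2
      _ = (M + 1) * (2 * exp (D ^ 2 / (4 * M))) := by simp
  have hEE : E * exp (D ^ 2 / (2 * M)) = exp (D ^ 2 / (4 * M)) := by
    rw [hE, ← exp_add]
    congr 1
    field_simp
    norm_num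
  have hbound' : B.card * (p ^ R * q ^ S) ≤ 2 * (M + 1) * E := by
    refine le_of_mul_le_mul_right ?_ (exp_pos (D ^ 2 / (2 * M)))
    rw [mul_assoc (_ * _) E, hEE]
    linarith
  have hN : (0 : ℝ) < M.choose R := by
    exact_mod_cast Nat.choose_pos (by omega)
  have hE0 : 0 < E := exp_pos _
  rw [div_lt_iff₀ hN]
  calc (B.card : ℝ) ≤ B.card * ((M + 1) * (M.choose R * (p ^ R * q ^ S))) :=
        le_mul_of_one_le_right (by positivity) hmode
    _ = (M + 1) * M.choose R * (B.card * (p ^ R * q ^ S)) := by ring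
    _ ≤ (M + 1) * M.choose R * (2 * (M + 1) * E) :=
        mul_le_mul_of_nonneg_left hbound' (by positivity)
    _ = 2 * (M + 1) ^ 2 * (E * M.choose R) := by ring
    _ < 48 * M ^ 3 * (E * M.choose R) := by
        refine mul_lt_mul_of_pos_right ?_ (by positivity)
        nlinarith [mul_nonneg (sub_nonneg.2 hM1) (sq_nonneg (M : ℝ)),
          mul_nonneg hM0.le (sub_nonneg.2 hM1)]
    _ = 48 * M ^ 3 * E * M.choose R := by ring
end

section
/- Fix a, b, c > 0 with a + b + c = 1, let θ = 1/2 + bc/(a+c) and λ = 1/2 + ab/(b+c), and let 𝔅 be the convex increasing curve parametrized by z ↦ (ζ'(z), z·ζ'(z) − ζ(z)), z ∈ [0,∞]. Let δ > 0 and let v = (x,y) lie weakly northwest of 𝔅 with d(v, 𝔅) > δ, x ∈ [θ+δ, 1+b−δ], y ∈ [δ, λ−δ]. Let u ∈ 𝔅 achieve d(v, 𝔅) = d(v, u) and let ℓ be the tangent line to 𝔅 at u. Then there exists a constant ϖ = ϖ(a,b,c) > 0, depending only on a, b, c, such that every w ∈ 𝔅 not lying weakly southeast of v satisfies d(w, ℓ)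 > ϖ·δ⁵. -/
open Real Filter

/-- The function `ζ(z)` from the arctic-curve parametrization. -/
noncomputable def zeta (a b c z : ℝ) : ℝ :=
  Real.sqrt (z ^ 2 + z + 1) + Real.sqrt ((z * b + z * c + a + c) ^ 2 - 4 * a * b * z) / 2 +
    ((b - c) * z - a - c) / 2 - 1

/-- The explicit derivative `ζ'(z)`. -/
noncomputable def zeta' (a b c z : ℝ) : ℝ :=
  (2 * z + 1) / (2 * Real.sqrt (z ^ 2 + z + 1)) +
    ((b + c) ^ 2 * z - a * b + a * c + b * c + c ^ 2) /
      (2 * Real.sqrt ((z * b + z * c + a + c) ^ 2 - 4 * a * b * z)) +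
    (b - c) / 2

/-- The `x`-coordinate of the curve `𝔅`. -/
noncomputable def xCurve (a b c z : ℝ) : ℝ := zeta' a b c z

/-- The `y`-coordinate of the curve `𝔅`. -/
noncomputable def yCurve (a b c z : ℝ) : ℝ := z * zeta' a b c z - zeta a b c z

/-- The arctic curve `𝔅` as a subset of the Euclidean plane, parametrized by
`z ∈ [0,∞]` (the point at `z = ∞` is the endpoint `(1+b, λ)`). -/
noncomputable def arcticCurve (a b c : ℝ) : Set (EuclideanSpace ℝ (Fin 2)) :=
  ((fun z => pt (xCurve a b c z) (yCurve a b c z)) '' Set.Ici 0) ∪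
    {pt (1 + b) (1 / 2 + a * b / (b + c))}

/-- A function with nonnegative derivative on `[s, t]` satisfies `F s ≤ F t`. -/
lemma le_of_hasDerivAt_nonneg {F F' : ℝ → ℝ} {s t : ℝ} (hst : s ≤ t)
    (hF : ∀ r, s ≤ r → r ≤ t → HasDerivAt F (F' r) r)
    (hF' : ∀ r, s ≤ r → r ≤ t → 0 ≤ F' r) : F s ≤ F t := by
  refine monotoneOn_of_hasDerivWithinAt_nonneg (f' := F') (convex_Icc s t)
    (fun r hr => (hF r hr.1 hr.2).continuousAt.continuousWithinAt)
    (fun r hr => ?_) (fun r hr => ?_) (Set.left_mem_Icc.2 hst) (Set.right_mem_Icc.2 hst) hst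
  · exact (hF r (interior_subset hr).1 (interior_subset hr).2).hasDerivWithinAt
  · exact hF' r (interior_subset hr).1 (interior_subset hr).2

/-- A twice differentiable convex function on `[0, ∞)` with derivative `g`, and with second
derivative `h` bounded by `C` and by `C / z ^ 3`. -/
structure CubicDecay (f g h : ℝ → ℝ) (C : ℝ) : Prop where
  deriv_f : ∀ z, 0 ≤ z → HasDerivAt f (g z) z
  deriv_g : ∀ z, 0 ≤ z → HasDerivAt g (h z) z
  pos : ∀ z, 0 ≤ z → 0 < h z
  le : ∀ z, 0 ≤ z → h z ≤ C
  cube_le : ∀ z, 0 ≤ z → z ^ 3 * h z ≤ C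

namespace CubicDecay

variable {f g h : ℝ → ℝ} {C : ℝ}

lemma deriv_legendre (H : CubicDecay f g h C) (z : ℝ) (hz : 0 ≤ z) :
    HasDerivAt (fun t => t * g t - f t) (z * h z) z := by
  have := ((hasDerivAt_id z).mul (H.deriv_g z hz)).sub (H.deriv_f z hz)
  refine this.congr_deriv ?_
  simp

lemma deriv_mono (H : CubicDecay f g h C) {s t : ℝ} (hs : 0 ≤ s) (hst : s ≤ t) : g s ≤ g t :=
  le_of_hasDerivAt_nonneg hst (fun r h1 _ => H.deriv_g r (hs.trans h1))
    (fun r h1 _ => (H.pos r (hs.trans h1)).le)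

lemma legendre_mono (H : CubicDecay f g h C) {s t : ℝ} (hs : 0 ≤ s) (hst : s ≤ t) :
    s * g s - f s ≤ t * g t - f t :=
  le_of_hasDerivAt_nonneg (F := fun t => t * g t - f t) hst
    (fun r h1 _ => H.deriv_legendre r (hs.trans h1))
    (fun r h1 _ => mul_nonneg (hs.trans h1) (H.pos r (hs.trans h1)).le)

lemma deriv_sub_le (H : CubicDecay f g h C) {s t : ℝ} (hs : 0 ≤ s) (hst : s ≤ t) :
    g t - g s ≤ C * (t - s) := by
  have := le_of_hasDerivAt_nonneg (F := fun r => C * r - g r) (F' := fun r => C * 1 - h r) hst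
    (fun r h1 _ => ((hasDerivAt_id r).const_mul C).sub (H.deriv_g r (hs.trans h1)))
    (fun r h1 _ => by simpa using H.le r (hs.trans h1))
  linarith

lemma legendre_sub_le (H : CubicDecay f g h C) {s t : ℝ} (hs : 0 < s) (hst : s ≤ t) :
    (t * g t - f t) - (s * g s - f s) ≤ C * (s⁻¹ - t⁻¹) := by
  have := le_of_hasDerivAt_nonneg (F := fun r => C * (-r⁻¹) - (r * g r - f r))
    (F' := fun r => C * (-(-(r ^ 2)⁻¹)) - r * h r) hst
    (fun r h1 _ => (((hasDerivAt_inv (hs.trans_le h1).ne').neg).const_mul C).sub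
      (H.deriv_legendre r (hs.le.trans h1)))
    (fun r h1 _ => by
      have hr : 0 < r := hs.trans_le h1
      have h3 := H.cube_le r hr.le
      have : C * (-(-(r ^ 2)⁻¹)) - r * h r = (C - r ^ 3 * h r) / r ^ 2 := by
        field_simp
      rw [this]
      exact div_nonneg (by linarith) (by positivity))
  linarith

/-- Points of the dual curve to the left of the point of tangency. -/
lemma sq_deriv_sub_le (H : CubicDecay f g h C) {s z : ℝ} (hs : 0 ≤ s) (hsz : s ≤ z) :
    (g z - g s) ^ 2 ≤ 2 * C * ((s * g s - f s) - (z * g s - f z)) := by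
  have := le_of_hasDerivAt_nonneg
    (F := fun r => (g z - g r) ^ 2 - 2 * C * ((r * g r - f r) - (z * g r - f z)))
    (F' := fun r => 2 * h r * (C * (z - r) - (g z - g r))) hsz
    (fun r h1 _ => by
      have h0 := hs.trans h1
      have := (((H.deriv_g r h0).const_sub (g z)).pow 2).sub
        (((H.deriv_legendre r h0).sub (((H.deriv_g r h0).const_mul z).sub_const (f z))).const_mul
          (2 * C))
      refine this.congr_deriv ?_
      push_cast
      ring)
    (fun r h1 h2 => by
      have h0 := hs.trans h1
      have h3 := H.deriv_sub_le h0 h2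
      exact mul_nonneg (by linarith [H.pos r h0]) (by linarith))
  nlinarith

/-- Points of the dual curve above the point of tangency. -/
lemma sq_legendre_sub_le (H : CubicDecay f g h C) {s z : ℝ} (hz : 0 < z) (hzs : z ≤ s) :
    z * ((s * g s - f s) - (z * g z - f z)) ^ 2 ≤
      2 * C * ((s * g s - f s) - (z * g s - f z)) := by
  have := le_of_hasDerivAt_nonneg
    (F := fun r => 2 * C * ((r * g r - f r) - (z * g r - f z)) -
      z * ((r * g r - f r) - (z * g z - f z)) ^ 2)
    (F' := fun r => 2 * h r *
      (C * (r - z) - z * r * ((r * g r - f r) - (z * g z - f z)))) hzs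
    (fun r h1 _ => by
      have h0 := hz.le.trans h1
      have := (((H.deriv_legendre r h0).sub
        (((H.deriv_g r h0).const_mul z).sub_const (f z))).const_mul (2 * C)).sub
        ((((H.deriv_legendre r h0).sub_const (z * g z - f z)).pow 2).const_mul z)
      refine this.congr_deriv ?_
      push_cast
      ring)
    (fun r h1 h2 => by
      have h0 := hz.trans_le h1
      have h3 := mul_le_mul_of_nonneg_left (H.legendre_sub_le hz h1) (mul_pos hz h0).le
      have h4 : z * r * (C * (z⁻¹ - r⁻¹)) = C * (r - z) := by
        field_simp
      exact mul_nonneg (by linarith [H.pos r h0.le]) (by linarith))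
  nlinarith

end CubicDecay

section Quadratic

variable {α β γ z : ℝ}

lemma hasDerivAt_sqrt_quadratic (hq : 0 < α * z ^ 2 + β * z + γ) :
    HasDerivAt (fun t => √(α * t ^ 2 + β * t + γ))
      ((2 * α * z + β) / (2 * √(α * z ^ 2 + β * z + γ))) z := by
  have h1 : HasDerivAt (fun t : ℝ => α * t ^ 2 + β * t + γ) (2 * α * z + β) z := by
    have := ((((hasDerivAt_id z).pow 2).const_mul α).add
      ((hasDerivAt_id z).const_mul β)).add_const γ
    refine this.congr_deriv ?_
    simp
    ring
  exact h1.sqrt hq.ne'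

lemma hasDerivAt_deriv_sqrt_quadratic (hq : 0 < α * z ^ 2 + β * z + γ) :
    HasDerivAt (fun t => (2 * α * t + β) / (2 * √(α * t ^ 2 + β * t + γ)))
      ((4 * α * γ - β ^ 2) / (4 * √(α * z ^ 2 + β * z + γ) ^ 3)) z := by
  have h1 : HasDerivAt (fun t : ℝ => 2 * α * t + β) (2 * α * 1) z :=
    ((hasDerivAt_id z).const_mul (2 * α)).add_const β
  have h3 : 0 < √(α * z ^ 2 + β * z + γ) := sqrt_pos.2 hq
  have h2 := h1.div ((hasDerivAt_sqrt_quadratic hq).const_mul 2) (by positivity)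
  refine h2.congr_deriv ?_
  have h4 : √(α * z ^ 2 + β * z + γ) ^ 2 = α * z ^ 2 + β * z + γ := sq_sqrt hq.le
  set r := √(α * z ^ 2 + β * z + γ)
  field_simp
  rw [h4]
  ring

lemma tendsto_linear_div_sqrt_quadratic (hα : 0 < α) (p q : ℝ) :
    Tendsto (fun t => (p * t + q) / √(α * t ^ 2 + β * t + γ)) atTop (nhds (p / √α)) := by
  have hi : Tendsto (fun t : ℝ => t⁻¹) atTop (nhds 0) := tendsto_inv_atTop_zero
  have h1 : Tendsto (fun t : ℝ => (p + q * t⁻¹) / √(α + β * t⁻¹ + γ * (t⁻¹) ^ 2)) atTop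
      (nhds ((p + q * 0) / √(α + β * 0 + γ * 0 ^ 2))) := by
    refine (tendsto_const_nhds.add (hi.const_mul q)).div
      (((tendsto_const_nhds.add (hi.const_mul β)).add ((hi.pow 2).const_mul γ)).sqrt) ?_
    simpa using (sqrt_pos.2 hα).ne'
  simp only [mul_zero, add_zero, ne_eq, OfNat.ofNat_ne_zero, not_false_eq_true, zero_pow] at h1
  refine h1.congr' ?_
  filter_upwards [eventually_gt_atTop 0] with t ht
  have : α * t ^ 2 + β * t + γ = t ^ 2 * (α + β * t⁻¹ + γ * (t⁻¹) ^ 2) := by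
    field_simp
  rw [this, sqrt_mul (by positivity), sqrt_sq ht.le]
  have : p * t + q = t * (p + q * t⁻¹) := by field_simp
  rw [this, mul_div_mul_left _ _ ht.ne']

end Quadratic

section Zeta

variable {a b c : ℝ}

lemma quadratic_two_eq (z : ℝ) : (z * b + z * c + a + c) ^ 2 - 4 * a * b * z =
    (b + c) ^ 2 * z ^ 2 + (2 * (b + c) * (a + c) - 4 * a * b) * z + (a + c) ^ 2 := by
  ring

lemma sq_le_quadratic_two (ha : 0 < a) (hb : 0 < b) (hc : 0 < c) {z : ℝ} (hz : 0 ≤ z) :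
    (c * (1 + z)) ^ 2 ≤
      (b + c) ^ 2 * z ^ 2 + (2 * (b + c) * (a + c) - 4 * a * b) * z + (a + c) ^ 2 := by
  have : 0 ≤ 2 * (b * z + a) * (c * (1 + z)) := by positivity
  nlinarith [sq_nonneg (b * z - a)]

/-- The second derivative of `zeta`. -/
noncomputable def zetaSecond (a b c z : ℝ) : ℝ :=
  3 / (4 * √(1 * z ^ 2 + 1 * z + 1) ^ 3) +
    2 * (a * b * c) /
      √((b + c) ^ 2 * z ^ 2 + (2 * (b + c) * (a + c) - 4 * a * b) * z + (a + c) ^ 2) ^ 3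

lemma zeta_eq : zeta a b c = fun z => √(1 * z ^ 2 + 1 * z + 1) +
    √((b + c) ^ 2 * z ^ 2 + (2 * (b + c) * (a + c) - 4 * a * b) * z + (a + c) ^ 2) / 2 +
    ((b - c) * z - a - c) / 2 - 1 := by
  funext z
  simp only [zeta, quadratic_two_eq, one_mul]

lemma zeta'_eq :
    zeta' a b c = fun z => (2 * 1 * z + 1) / (2 * √(1 * z ^ 2 + 1 * z + 1)) +
    (2 * (b + c) ^ 2 * z + (2 * (b + c) * (a + c) - 4 * a * b)) / (2 * √((b + c) ^ 2 * z ^ 2 +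
      (2 * (b + c) * (a + c) - 4 * a * b) * z + (a + c) ^ 2)) / 2 + (b - c) / 2 := by
  funext z
  simp only [zeta', quadratic_two_eq, one_mul, mul_one]
  congr 2
  rw [div_right_comm]
  congr 1
  ring

lemma zeta_cubicDecay (ha : 0 < a) (hb : 0 < b) (hc : 0 < c) (habc : a + b + c = 1) :
    CubicDecay (zeta a b c) (zeta' a b c) (zetaSecond a b c) (6 + 2 * (a * b * c) / c ^ 3) := by
  have hq1 : ∀ z : ℝ, 0 ≤ z → ((1 + z) / 2) ^ 2 ≤ 1 * z ^ 2 + 1 * z + 1 := fun z hz => by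
    nlinarith
  have hq1' : ∀ z : ℝ, 0 ≤ z → 0 < 1 * z ^ 2 + 1 * z + 1 := fun z hz => by positivity
  have hq2 : ∀ z : ℝ, 0 ≤ z → _ := fun z hz => sq_le_quadratic_two ha hb hc hz
  have hq2' : ∀ z : ℝ, 0 ≤ z → 0 < (b + c) ^ 2 * z ^ 2 +
      (2 * (b + c) * (a + c) - 4 * a * b) * z + (a + c) ^ 2 := fun z hz =>
    lt_of_lt_of_le (by positivity) (hq2 z hz)
  have hbound : ∀ z, 0 ≤ z →
      (1 + z) ^ 3 * zetaSecond a b c z ≤ 6 + 2 * (a * b * c) / c ^ 3 := fun z hz => by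
    have h1 : (1 + z) / 2 ≤ √(1 * z ^ 2 + 1 * z + 1) := le_sqrt_of_sq_le (hq1 z hz)
    have h2 := le_sqrt_of_sq_le (hq2 z hz)
    have h3 : 3 / (4 * √(1 * z ^ 2 + 1 * z + 1) ^ 3) ≤ 3 / (4 * ((1 + z) / 2) ^ 3) := by
      gcongr
    have h4 : 2 * (a * b * c) / √((b + c) ^ 2 * z ^ 2 +
        (2 * (b + c) * (a + c) - 4 * a * b) * z + (a + c) ^ 2) ^ 3 ≤
        2 * (a * b * c) / (c * (1 + z)) ^ 3 := by
      gcongr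
    calc (1 + z) ^ 3 * zetaSecond a b c z
        ≤ (1 + z) ^ 3 * (3 / (4 * ((1 + z) / 2) ^ 3) + 2 * (a * b * c) / (c * (1 + z)) ^ 3) :=
          mul_le_mul_of_nonneg_left (add_le_add h3 h4) (by positivity)
      _ = 6 + 2 * (a * b * c) / c ^ 3 := by
          field_simp
          ring
  have hpos : ∀ z, 0 ≤ z → 0 < zetaSecond a b c z := fun z hz => by
    have h1 := sqrt_pos.2 (hq1' z hz)
    have h2 := sqrt_pos.2 (hq2' z hz)
    unfold zetaSecond
    positivity
  refine ⟨fun z hz => ?_, fun z hz => ?_, hpos, fun z hz => ?_, fun z hz => ?_⟩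
  · rw [zeta_eq, zeta'_eq]
    have := (((hasDerivAt_sqrt_quadratic (hq1' z hz)).add
      ((hasDerivAt_sqrt_quadratic (hq2' z hz)).div_const 2)).add
      (((((hasDerivAt_id z).const_mul (b - c)).sub_const a).sub_const c).div_const 2)).sub_const 1
    refine this.congr_deriv ?_
    simp
  · rw [zeta'_eq]
    have := ((hasDerivAt_deriv_sqrt_quadratic (hq1' z hz)).add
      ((hasDerivAt_deriv_sqrt_quadratic (hq2' z hz)).div_const 2)).add_const ((b - c) / 2)
    refine this.congr_deriv ?_
    have hdisc : 4 * (b + c) ^ 2 * (a + c) ^ 2 - (2 * (b + c) * (a + c) - 4 * a * b) ^ 2 =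
        16 * (a * b * c) := by
      obtain rfl : c = 1 - a - b := by linarith
      ring
    unfold zetaSecond
    rw [hdisc]
    have h2 := (sqrt_pos.2 (hq2' z hz)).ne'
    have h1 := (sqrt_pos.2 (hq1' z hz)).ne'
    congr 1
    · norm_num
    · field_simp
      norm_num
  · refine le_trans ?_ (hbound z hz)
    have : 1 ≤ (1 + z) ^ 3 := one_le_pow₀ (by linarith)
    nlinarith [hpos z hz]
  · refine le_trans ?_ (hbound z hz)
    have : z ^ 3 ≤ (1 + z) ^ 3 := by gcongr; linarith
    nlinarith [hpos z hz]

lemma zeta'_zero (ha : 0 < a) (hc : 0 < c) : zeta' a b c 0 = 1 / 2 + b * c / (a + c) := by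
  have h : √((0 * b + 0 * c + a + c) ^ 2 - 4 * a * b * 0) = a + c := by
    rw [← sqrt_sq (show 0 ≤ a + c by positivity)]
    congr 1
    ring
  rw [zeta', h]
  norm_num
  field_simp
  ring

lemma tendsto_xCurve (hb : 0 < b) (hc : 0 < c) :
    Tendsto (xCurve a b c) atTop (nhds (1 + b)) := by
  have h1 := tendsto_linear_div_sqrt_quadratic (β := 1) (γ := 1) one_pos (1 : ℝ) (1 / 2)
  have h2 := tendsto_linear_div_sqrt_quadratic (α := (b + c) ^ 2)
    (β := 2 * (b + c) * (a + c) - 4 * a * b) (γ := (a + c) ^ 2) (by positivity)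
    ((b + c) ^ 2 / 2) ((2 * (b + c) * (a + c) - 4 * a * b) / 4)
  have h3 := (h1.add h2).add_const ((b - c) / 2)
  rw [sqrt_sq (by positivity), sqrt_one] at h3
  have : (1 : ℝ) / 1 + (b + c) ^ 2 / 2 / (b + c) + (b - c) / 2 = 1 + b := by
    field_simp
    ring
  rw [this] at h3
  refine h3.congr fun z => ?_
  rw [xCurve, zeta'_eq]
  simp only [div_eq_mul_inv, mul_inv]
  ring

lemma tendsto_yCurve (ha : 0 < a) (hb : 0 < b) (hc : 0 < c) :
    Tendsto (yCurve a b c) atTop (nhds (1 / 2 + a * b / (b + c))) := by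
  have h1 := tendsto_linear_div_sqrt_quadratic (β := 1) (γ := 1) one_pos (-1 / 2 : ℝ) (-1)
  have h2 := tendsto_linear_div_sqrt_quadratic (α := (b + c) ^ 2)
    (β := 2 * (b + c) * (a + c) - 4 * a * b) (γ := (a + c) ^ 2) (by positivity)
    (-(2 * (b + c) * (a + c) - 4 * a * b) / 4) (-(a + c) ^ 2 / 2)
  have h3 := (h1.add h2).add_const ((a + c) / 2 + 1)
  rw [sqrt_sq (by positivity), sqrt_one] at h3
  have : (-1 / 2 : ℝ) / 1 + -(2 * (b + c) * (a + c) - 4 * a * b) / 4 / (b + c) +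
      ((a + c) / 2 + 1) = 1 / 2 + a * b / (b + c) := by
    field_simp
    ring
  rw [this] at h3
  refine h3.congr' ?_
  filter_upwards [eventually_ge_atTop 0] with z hz
  rw [yCurve, zeta'_eq, zeta_eq]
  have hq1 : 0 < 1 * z ^ 2 + 1 * z + 1 := by positivity
  have hq2 : 0 < (b + c) ^ 2 * z ^ 2 +
      (2 * (b + c) * (a + c) - 4 * a * b) * z + (a + c) ^ 2 :=
    lt_of_lt_of_le (by positivity) (sq_le_quadratic_two ha hb hc hz)
  have e1 := sq_sqrt hq1.le
  have e2 := sq_sqrt hq2.le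
  have p1 := sqrt_pos.2 hq1
  have p2 := sqrt_pos.2 hq2
  simp only
  set r := √(1 * z ^ 2 + 1 * z + 1)
  set t := √((b + c) ^ 2 * z ^ 2 + (2 * (b + c) * (a + c) - 4 * a * b) * z + (a + c) ^ 2)
  have f1 : (-1 / 2 * z + -1) / r = z * ((2 * 1 * z + 1) / (2 * r)) - r := by
    field_simp
    rw [e1]
    ring
  have f2 : (-(2 * (b + c) * (a + c) - 4 * a * b) / 4 * z + -(a + c) ^ 2 / 2) / t =
      z * ((2 * (b + c) ^ 2 * z + (2 * (b + c) * (a + c) - 4 * a * b)) / (2 * t) / 2) - t / 2 := by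
    field_simp
    rw [e2]
    ring
  rw [f1, f2]
  ring

end Zeta

@[simp] lemma pt_zero (x y : ℝ) : pt x y 0 = x := rfl

@[simp] lemma pt_one (x y : ℝ) : pt x y 1 = y := rfl

lemma dist_sq_plane (p q : EuclideanSpace ℝ (Fin 2)) :
    dist p q ^ 2 = (p 0 - q 0) ^ 2 + (p 1 - q 1) ^ 2 := by
  rw [EuclideanSpace.dist_eq, sq_sqrt (by positivity), Fin.sum_univ_two, Real.dist_eq,
    Real.dist_eq, sq_abs, sq_abs]

/-- The distance of a point to a nonvertical line. -/
lemma div_sqrt_le_infDist_line (w : EuclideanSpace ℝ (Fin 2)) (m k : ℝ) :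
    (w 1 - (m * w 0 - k)) / √(1 + m ^ 2) ≤
      Metric.infDist w {q : EuclideanSpace ℝ (Fin 2) | q 1 = m * q 0 - k} := by
  refine (Metric.le_infDist ⟨pt 0 (-k), by simp⟩).2 fun q hq => ?_
  have hq' : q 1 = m * q 0 - k := hq
  rw [div_le_iff₀ (by positivity)]
  refine le_of_sq_le_sq ?_ (by positivity)
  rw [mul_pow, dist_sq_plane, sq_sqrt (by positivity), hq']
  nlinarith [sq_nonneg ((w 0 - q 0) + m * (w 1 - (m * q 0 - k)))]

/-- The lower bound on the separation in terms of the slope `z` of the tangent. -/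
lemma separation_estimate {C δ z τ G : ℝ} (hC : 1 ≤ C) (hδ : 0 < δ) (hz : 0 < z)
    (h1 : δ ≤ C * z) (h2 : z * δ ≤ C) (hτ : δ ^ 2 ≤ τ ^ 2 * (1 + z ^ 2))
    (hG : min z (z ^ 2) * τ ^ 2 ≤ 2 * C * G) :
    1 / (16 * C ^ 4) * δ ^ 5 < G / √(1 + z ^ 2) := by
  have hC0 : 0 < C := by linarith
  obtain ⟨D, rfl⟩ : ∃ D, δ = C * D := ⟨δ / C, by field_simp⟩
  have hD : 0 < D := pos_of_mul_pos_right hδ hC0.le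
  have hDz : D ≤ z := le_of_mul_le_mul_left h1 hC0
  have hzD : z * D ≤ 1 := by
    refine le_of_mul_le_mul_left ?_ hC0
    linarith
  have hr : √(1 + z ^ 2) ^ 2 = 1 + z ^ 2 := sq_sqrt (by positivity)
  have hr0 : 0 < √(1 + z ^ 2) := sqrt_pos.2 (by positivity)
  set r := √(1 + z ^ 2)
  have key : D ^ 3 * r ^ 3 ≤ 4 * min z (z ^ 2) := by
    rcases le_total z 1 with hz1 | hz1
    · rw [min_eq_right (by nlinarith)]
      have hr1 : r ≤ 3 / 2 := by nlinarith
      have hr3 : r ^ 3 ≤ 4 := (pow_le_pow_left₀ hr0.le hr1 3).trans (by norm_num)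
      have hD3 : D ^ 3 ≤ z ^ 2 := by
        have : D ^ 2 ≤ z ^ 2 := by gcongr
        nlinarith [sq_nonneg D]
      calc D ^ 3 * r ^ 3 ≤ z ^ 2 * 4 := by gcongr
        _ = 4 * z ^ 2 := by ring
    · rw [min_eq_left (by nlinarith)]
      have hr1 : r ≤ 3 / 2 * z := by nlinarith
      calc D ^ 3 * r ^ 3 ≤ D ^ 3 * (3 / 2 * z) ^ 3 := by gcongr
        _ = 27 / 8 * (z * D) ^ 3 := by ring
        _ ≤ 27 / 8 * 1 := by
          gcongr
          exact pow_le_one₀ (by positivity) hzD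
        _ ≤ 4 * z := by linarith
  rw [← hr] at hτ
  have h3 : D ^ 3 * r * (C * D) ^ 2 ≤ 8 * C * G := by
    calc D ^ 3 * r * (C * D) ^ 2 ≤ D ^ 3 * r * (τ ^ 2 * r ^ 2) := by gcongr
      _ = D ^ 3 * r ^ 3 * τ ^ 2 := by ring
      _ ≤ 4 * min z (z ^ 2) * τ ^ 2 := by gcongr
      _ ≤ 8 * C * G := by linarith
  have h4 : 0 < D ^ 3 * r * (C * D) ^ 2 := by positivity
  rw [lt_div_iff₀ hr0]
  have h5 : 1 / (16 * C ^ 4) * (C * D) ^ 5 * r = D ^ 3 * r * (C * D) ^ 2 / (16 * C) := by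
    field_simp
  rw [h5, div_lt_iff₀ (by positivity)]
  linarith

/-- First-order condition at a closest point of the curve. -/
lemma CubicDecay.closest_point {f g h : ℝ → ℝ} {C p q z : ℝ} (H : CubicDecay f g h C)
    (hz : 0 ≤ z) (hp : g 0 < p)
    (hmin : ∀ s, 0 ≤ s → (p - g z) ^ 2 + (q - (z * g z - f z)) ^ 2 ≤
      (p - g s) ^ 2 + (q - (s * g s - f s)) ^ 2) :
    0 < z ∧ g z - p = z * (q - (z * g z - f z)) := by
  have hd : HasDerivAt (fun s => (p - g s) ^ 2 + (q - (s * g s - f s)) ^ 2)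
      (2 * h z * ((g z - p) - z * (q - (z * g z - f z)))) z := by
    refine ((((H.deriv_g z hz).const_sub p).pow 2).add
      (((H.deriv_legendre z hz).const_sub q).pow 2)).congr_deriv ?_
    push_cast
    ring
  have hpos := H.pos z hz
  have hz' : 0 < z := by
    refine lt_of_le_of_ne hz fun h0 => ?_
    subst h0
    have hneg : 2 * h 0 * ((g 0 - p) - 0 * (q - (0 * g 0 - f 0))) < 0 := by
      nlinarith
    have hs := (hasDerivWithinAt_iff_tendsto_slope' (s := Set.Ioi (0 : ℝ)) (by simp)).1
      hd.hasDerivWithinAt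
    obtain ⟨s, hs1, hs2⟩ := ((hs.eventually_lt_const hneg).and self_mem_nhdsWithin).exists
    have hs3 : (0 : ℝ) < s := hs2
    have := hmin s hs3.le
    rw [slope_def_field, div_neg_iff] at hs1
    rcases hs1 with h' | h' <;> linarith [h'.1, h'.2]
  refine ⟨hz', ?_⟩
  have hloc : IsLocalMin (fun s => (p - g s) ^ 2 + (q - (s * g s - f s)) ^ 2) z := by
    filter_upwards [lt_mem_nhds hz'] with s hs using hmin s (le_of_lt hs)
  have := hloc.hasDerivAt_eq_zero hd
  rcases mul_eq_zero.1 this with h' | h'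
  · linarith
  · linarith

/-- Quantified convexity of `𝔅` (Lemma on tangent-line separation): there is a constant
`ϖ = ϖ(a,b,c) > 0` such that whenever `v` lies weakly northwest of `𝔅` at distance `> δ`
from it, with coordinates in `[θ+δ, 1+b−δ] × [δ, λ−δ]`, `u ∈ 𝔅` is a closest point of `𝔅`
to `v`, and `ℓ` is the tangent line to `𝔅` at `u`, then every `w ∈ 𝔅` not lying weakly
southeast of `v` satisfies `d(w, ℓ) > ϖ δ⁵`. -/
theorem tangent_separation (a b c : ℝ) (ha : 0 < a) (hb : 0 < b) (hc : 0 < c)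
    (habc : a + b + c = 1) :
    ∃ ϖ : ℝ, 0 < ϖ ∧
      ∀ (δ : ℝ) (v u : EuclideanSpace ℝ (Fin 2)) (z : ℝ)
        (ℓ : Set (EuclideanSpace ℝ (Fin 2))),
        0 < δ →
        (∃ u' ∈ arcticCurve a b c, v 0 ≤ u' 0 ∧ u' 1 ≤ v 1) →
        Metric.infDist v (arcticCurve a b c) > δ →
        1 / 2 + b * c / (a + c) + δ ≤ v 0 → v 0 ≤ 1 + b - δ →
        δ ≤ v 1 → v 1 ≤ 1 / 2 + a * b / (b + c) - δ →
        u ∈ arcticCurve a b c → dist v u = Metric.infDist v (arcticCurve a b c) →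
        0 ≤ z → u = pt (xCurve a b c z) (yCurve a b c z) →
        ℓ = {q : EuclideanSpace ℝ (Fin 2) | q 1 = z * q 0 - zeta a b c z} →
        ∀ w ∈ arcticCurve a b c, ¬(v 0 ≤ w 0 ∧ w 1 ≤ v 1) →
          Metric.infDist w ℓ > ϖ * δ ^ 5 := by
  obtain ⟨C, hC, H⟩ : ∃ C, 1 ≤ C ∧
      CubicDecay (zeta a b c) (zeta' a b c) (zetaSecond a b c) C := by
    refine ⟨_, ?_, zeta_cubicDecay ha hb hc habc⟩
    have : 0 < 2 * (a * b * c) / c ^ 3 := by positivity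
    linarith
  have hlimx := tendsto_xCurve (a := a) hb hc
  have hlimy := tendsto_yCurve ha hb hc
  have hx0 : zeta' a b c 0 = 1 / 2 + b * c / (a + c) := zeta'_zero ha hc
  set θ := 1 / 2 + b * c / (a + c)
  set lam := 1 / 2 + a * b / (b + c)
  refine ⟨1 / (16 * C ^ 4), by positivity, ?_⟩
  rintro δ v u z ℓ hδ ⟨u', hu', hu'0, hu'1⟩ hdist hv0 hv0' hv1 hv1' - huv hz rfl rfl w hw hwv
  have hmin : ∀ s, 0 ≤ s →
      (v 0 - zeta' a b c z) ^ 2 + (v 1 - (z * zeta' a b c z - zeta a b c z)) ^ 2 ≤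
      (v 0 - zeta' a b c s) ^ 2 + (v 1 - (s * zeta' a b c s - zeta a b c s)) ^ 2 := by
    intro s hs
    have h1 : dist v (pt (xCurve a b c z) (yCurve a b c z)) ≤
        dist v (pt (xCurve a b c s) (yCurve a b c s)) := by
      rw [huv]
      exact Metric.infDist_le_dist_of_mem (Or.inl ⟨s, hs, rfl⟩)
    have h2 := pow_le_pow_left₀ dist_nonneg h1 2
    simpa only [dist_sq_plane, pt_zero, pt_one, xCurve, yCurve] using h2
  obtain ⟨hz0, hperp⟩ := H.closest_point hz (by linarith) hmin
  have hd2 : δ ^ 2 < (v 0 - zeta' a b c z) ^ 2 +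
      (v 1 - (z * zeta' a b c z - zeta a b c z)) ^ 2 := by
    have h2 := pow_lt_pow_left₀ (huv ▸ hdist) hδ.le two_ne_zero
    simpa only [dist_sq_plane, pt_zero, pt_one, xCurve, yCurve] using h2
  obtain ⟨τ, hτ⟩ : ∃ τ, τ = v 1 - (z * zeta' a b c z - zeta a b c z) := ⟨_, rfl⟩
  rw [← hτ] at hperp hd2
  have hd3 : δ ^ 2 < τ ^ 2 * (1 + z ^ 2) := by
    rw [show v 0 - zeta' a b c z = -(z * τ) by linarith] at hd2
    linarith
  have hτ0 : 0 < τ := by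
    by_contra! hneg
    rcases hneg.lt_or_eq with hneg | rfl
    · have hx : zeta' a b c z < v 0 := by nlinarith
      rcases hu' with ⟨s, hs, rfl⟩ | rfl
      · simp only [pt_zero, pt_one, xCurve, yCurve] at hu'0 hu'1
        rcases le_total s z with hsz | hsz
        · linarith [H.deriv_mono hs hsz]
        · linarith [H.legendre_mono hz hsz]
      · have : lam ≤ v 1 := hu'1
        linarith
    · nlinarith
  have hzlow : δ ≤ C * z := by
    have := H.deriv_sub_le le_rfl hz
    nlinarith
  have hzup : z * δ ≤ C := by
    have h1 : lam - (z * zeta' a b c z - zeta a b c z) ≤ C * z⁻¹ := by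
      refine le_of_tendsto (hlimy.sub_const _) ?_
      filter_upwards [eventually_ge_atTop z] with s hs
      have h2 := H.legendre_sub_le hz0 hs
      have h3 : 0 ≤ C * s⁻¹ := by
        have := hz0.trans_le hs
        positivity
      simp only [yCurve]
      linarith
    have h2 : δ ≤ C * z⁻¹ := by linarith
    rwa [← div_eq_mul_inv, le_div_iff₀ hz0, mul_comm] at h2
  refine lt_of_lt_of_le ?_ (div_sqrt_le_infDist_line w z (zeta a b c z))
  refine separation_estimate hC hδ hz0 hzlow hzup hd3.le ?_
  have hcase2 : ∀ Y G : ℝ, τ ≤ Y → z * Y ^ 2 ≤ 2 * C * G → min z (z ^ 2) * τ ^ 2 ≤ 2 * C * G := by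
    intro Y G hY hYG
    refine le_trans ?_ hYG
    gcongr
    exact min_le_left _ _
  rcases hw with ⟨s, hs, rfl⟩ | rfl
  · simp only [pt_zero, pt_one, xCurve, yCurve] at hwv ⊢
    have hs : 0 ≤ s := hs
    by_cases hxs : v 0 ≤ zeta' a b c s
    · have hys : v 1 < s * zeta' a b c s - zeta a b c s := by
        by_contra! hcon
        exact hwv ⟨hxs, hcon⟩
      have hzs : z ≤ s := by
        by_contra! hcon
        linarith [H.legendre_mono hs hcon.le]
      exact hcase2 _ _ (by linarith) (H.sq_legendre_sub_le hz0 hzs)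
    · have hsz : s ≤ z := by
        by_contra! hcon
        nlinarith [H.deriv_mono hz hcon.le]
      refine le_trans ?_ (H.sq_deriv_sub_le hs hsz)
      calc min z (z ^ 2) * τ ^ 2 ≤ z ^ 2 * τ ^ 2 := by gcongr; exact min_le_right _ _
        _ = (z * τ) ^ 2 := by ring
        _ ≤ _ := by
          gcongr
          linarith
  · simp only [pt_zero, pt_one]
    refine hcase2 (lam - (z * zeta' a b c z - zeta a b c z)) _ (by linarith) ?_
    refine le_of_tendsto_of_tendsto (((hlimy.sub_const _).pow 2).const_mul z)
      ((hlimy.sub ((hlimx.const_mul z).sub_const (zeta a b c z))).const_mul (2 * C)) ?_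
    filter_upwards [eventually_ge_atTop z] with s hs
    exact H.sq_legendre_sub_le hz0 hs
end
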